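/- Fix a finite set Γ of γ ≥ 1 distinct literals on the variables x_1,…,x_{n_0}. For n ≥ n_0, let 𝒜_Γ be the family of associative trees on n variables having at least one leaf among the children of the root labelled by a literal of Γ. Then the limiting ratio μ_n(𝒜_Γ) exists for every n ≥ n_0 and satisfies μ_n(𝒜_Γ) = γ·√(2/n) + O(1/n) as n → ∞. -/

import Mathlib

/-- An and/or tree skeleton: leaves carry a variable index and a polarity
(`true` = positive literal, `false` = negated literal); internal nodes carry
a connective (`true` = AND, `false` = OR) and a list of children. -/
inductive AT (n : ℕ) : Type
  | leaf : Fin n → Bool → AT n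
  | node : Bool → List (AT n) → AT n

namespace AT

/-- The connective at the root, if the root is an internal node. -/
def rootConn {n : ℕ} : AT n → Option Bool
  | .leaf _ _ => none
  | .node c _ => some c

/-- Whether a tree is a single leaf. -/
def isLeafB {n : ℕ} : AT n → Bool
  | .leaf _ _ => true
  | .node _ _ => false

/-- The children of the root. -/
def rootChildren {n : ℕ} : AT n → List (AT n)
  | .leaf _ _ => []
  | .node _ ts => ts

/-- Well-formedness: an associative tree is a plane tree in which each internal
node has at least two children, no internal node has the same connective as its
parent (stratification), and leaves carry literals. -/
inductive WF {n : ℕ} : AT n → Prop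
  | leaf (i : Fin n) (b : Bool) : WF (.leaf i b)
  | node (c : Bool) (ts : List (AT n)) :
      2 ≤ ts.length → (∀ t ∈ ts, WF t) → (∀ t ∈ ts, rootConn t ≠ some c) →
      WF (.node c ts)

mutual
/-- The size of a tree: its total number of nodes. -/
def size {n : ℕ} : AT n → ℕ
  | .leaf _ _ => 1
  | .node _ ts => 1 + sizeList ts
def sizeList {n : ℕ} : List (AT n) → ℕ
  | [] => 0
  | t :: ts => size t + sizeList ts
end

mutual
/-- The Boolean function computed by a tree. -/
def eval {n : ℕ} : AT n → (Fin n → Bool) → Bool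
  | .leaf i b, x => if b then x i else ! x i
  | .node c ts, x => evalList c ts x
def evalList {n : ℕ} : Bool → List (AT n) → (Fin n → Bool) → Bool
  | c, [], _ => c
  | c, t :: ts, x => if c then eval t x && evalList c ts x
                     else eval t x || evalList c ts x
end

end AT

open AT

/-- Number of associative trees of size `m` in a family `𝒯`. -/
noncomputable def countIn (n : ℕ) (𝒯 : Set (AT n)) (m : ℕ) : ℕ :=
  Nat.card {t : AT n // t ∈ 𝒯 ∧ WF t ∧ size t = m}

/-- `A n m` is the number of associative trees of size `m` on `n` variables. -/
noncomputable def A (n m : ℕ) : ℕ := countIn n Set.univ m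

/-- `Pmn n m f` is the proportion, among associative trees of size `m` on `n`
variables, of those computing the Boolean function `f`. -/
noncomputable def Pmn (n m : ℕ) (f : (Fin n → Bool) → Bool) : ℝ :=
  (countIn n {t | eval t = f} m : ℝ) / (A n m : ℝ)

/-- Ratio of trees of size `m` in the family `𝒯` among all trees of size `m`. -/
noncomputable def ratio (n : ℕ) (𝒯 : Set (AT n)) (m : ℕ) : ℝ :=
  (countIn n 𝒯 m : ℝ) / (A n m : ℝ)

/-- `HasLimRatio n 𝒯 μ` : the limiting ratio of the family `𝒯` exists and is `μ`. -/
def HasLimRatio (n : ℕ) (𝒯 : Set (AT n)) (μ : ℝ) : Prop :=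
  Filter.Tendsto (ratio n 𝒯) Filter.atTop (nhds μ)

/-- Extension of a Boolean function of `n₀` variables to `n ≥ n₀` variables. -/
def extend {n₀ n : ℕ} (h : n₀ ≤ n) (f : (Fin n₀ → Bool) → Bool) :
    (Fin n → Bool) → Bool :=
  fun x => f (fun j => x (Fin.castLE h j))

open Classical in
/-- The tree size complexity of a Boolean function. -/
noncomputable def Lcomp (n : ℕ) (f : (Fin n → Bool) → Bool) : ℕ :=
  if f = (fun _ => true) ∨ f = (fun _ => false) then 0
  else if ∃ i : Fin n, f = (fun x => x i) ∨ f = (fun x => ! x i) then 2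
  else sInf {m | ∃ t : AT n, WF t ∧ size t = m ∧ eval t = f}

/-- The family `𝒜_Γ` of associative trees on `n ≥ n₀` variables having at least one
leaf among the children of the root labelled by a literal of `Γ` (a set of literals
on the variables `x_1, …, x_{n₀}`). -/
def famGamma {n₀ n : ℕ} (h : n₀ ≤ n) (Γ : Finset (Fin n₀ × Bool)) : Set (AT n) :=
  {t | ∃ l ∈ Γ, AT.leaf (Fin.castLE h l.1) l.2 ∈ rootChildren t}


namespace AT

variable {n : ℕ}

theorem size_pos (t : AT n) : 1 ≤ size t := by
  cases t <;> simp [size]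

theorem length_le_sizeList (ts : List (AT n)) : ts.length ≤ sizeList ts := by
  induction ts with
  | nil => simp [sizeList]
  | cons t ts ih => have := size_pos t; simp [sizeList]; omega

theorem finite_aux (m : ℕ) :
    {t : AT n | size t ≤ m}.Finite ∧ {ts : List (AT n) | sizeList ts ≤ m}.Finite := by
  induction m with
  | zero =>
    refine ⟨?_, ?_⟩
    · convert Set.finite_empty
      ext t
      have := size_pos t
      simp; omega
    · refine (Set.finite_singleton ([] : List (AT n))).subset ?_
      intro ts hts
      have := length_le_sizeList ts
      simp only [Set.mem_ofPred_eq] at hts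
      exact List.length_eq_zero_iff.mp (by omega)
  | succ m ih =>
    have h1 : {t : AT n | size t ≤ m + 1}.Finite := by
      refine ((Set.finite_range (fun p : Fin n × Bool => AT.leaf p.1 p.2)).union
        (Set.Finite.image2 AT.node (Set.finite_univ (α := Bool)) ih.2)).subset ?_
      intro t ht
      cases t with
      | leaf i b => left; exact ⟨(i, b), rfl⟩
      | node c ts =>
        right
        refine ⟨c, trivial, ts, ?_, rfl⟩
        simp [size] at ht ⊢; omega
    refine ⟨h1, ?_⟩
    refine ((Set.finite_singleton ([] : List (AT n))).union
        (Set.Finite.image2 List.cons h1 ih.2)).subset ?_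
    intro ts hts
    cases ts with
    | nil => left; rfl
    | cons t ts =>
      right
      have := size_pos t
      simp [sizeList] at hts
      refine ⟨t, ?_, ts, ?_, rfl⟩ <;> simp <;> omega

theorem finite_size (P : AT n → Prop) (m : ℕ) : {t : AT n | P t ∧ size t = m}.Finite :=
  (finite_aux m).1.subset (fun _ ht => ht.2.le)

theorem finite_sizeList (P : List (AT n) → Prop) (m : ℕ) :
    {ts : List (AT n) | P ts ∧ sizeList ts = m}.Finite :=
  (finite_aux m).2.subset (fun _ ht => ht.2.le)

/-- Number of trees with property `P` of size `m`. -/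
noncomputable def cnt (P : AT n → Prop) (m : ℕ) : ℕ := {t : AT n | P t ∧ size t = m}.ncard

/-- Number of lists of trees with property `P` of total size `m`. -/
noncomputable def lcnt (P : AT n → Prop) (m : ℕ) : ℕ :=
  {ts : List (AT n) | (∀ t ∈ ts, P t) ∧ sizeList ts = m}.ncard

/-- Number of lists of length at least two of trees with property `P` of total size `m`. -/
noncomputable def ncnt (P : AT n → Prop) (m : ℕ) : ℕ :=
  {ts : List (AT n) | (2 ≤ ts.length ∧ ∀ t ∈ ts, P t) ∧ sizeList ts = m}.ncard

theorem cnt_zero (P : AT n → Prop) : cnt P 0 = 0 := by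
  unfold cnt
  rw [Set.ncard_eq_zero (finite_size _ _)]
  ext t
  have := size_pos t
  simp; omega

theorem lcnt_zero (P : AT n → Prop) : lcnt P 0 = 1 := by
  unfold lcnt
  rw [Set.ncard_eq_one]
  refine ⟨[], ?_⟩
  ext ts
  have := length_le_sizeList ts
  constructor
  · intro h
    exact List.length_eq_zero_iff.mp (by have := h.2; omega)
  · rintro rfl
    simp [sizeList]

theorem lcnt_succ (P : AT n → Prop) (m : ℕ) :
    lcnt P (m + 1) = ∑ p ∈ Finset.HasAntidiagonal.antidiagonal (m + 1), cnt P p.1 * lcnt P p.2 := by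
  classical
  have key : {ts : List (AT n) | (∀ t ∈ ts, P t) ∧ sizeList ts = m + 1} =
      ((Finset.HasAntidiagonal.antidiagonal (m + 1)).biUnion (fun p =>
        ((finite_size P p.1).toFinset ×ˢ
          (finite_sizeList (fun ts => ∀ t ∈ ts, P t) p.2).toFinset).image
            (fun q => q.1 :: q.2)) : Finset (List (AT n))) := by
    ext ts
    simp only [Set.mem_ofPred_eq, Finset.coe_biUnion, Finset.mem_coe, Set.mem_iUnion,
      Finset.HasAntidiagonal.mem_antidiagonal, Finset.mem_image, Finset.mem_product, Set.Finite.mem_toFinset,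
      Prod.exists]
    cases ts with
    | nil => simp [sizeList]
    | cons t ts =>
      simp only [List.mem_cons, forall_eq_or_imp, sizeList]
      constructor
      · rintro ⟨⟨h1, h2⟩, h3⟩
        exact ⟨_, _, h3, t, ts, ⟨⟨h1, rfl⟩, h2, rfl⟩, rfl⟩
      · rintro ⟨i, j, hij, a, b, ⟨⟨h1, h2⟩, h3, h4⟩, h5⟩
        obtain ⟨rfl, rfl⟩ := List.cons.inj h5
        exact ⟨⟨h1, h3⟩, by omega⟩
  unfold lcnt
  rw [key, Set.ncard_coe_finset, Finset.card_biUnion]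
  · refine Finset.sum_congr rfl fun p _ => ?_
    rw [Finset.card_image_of_injective, Finset.card_product, cnt,
      Set.ncard_eq_toFinset_card _ (finite_size _ _),
      Set.ncard_eq_toFinset_card _ (finite_sizeList _ _)]
    rintro ⟨a, b⟩ ⟨c, d⟩ h
    simpa using h
  · intro p _ q _ hpq
    rw [Function.onFun, Finset.disjoint_left]
    intro ts h1 h2
    simp only [Finset.mem_image, Finset.mem_product, Set.Finite.mem_toFinset,
      Prod.exists, Set.mem_ofPred_eq] at h1 h2
    obtain ⟨a, b, ⟨⟨_, h3⟩, _, h4⟩, rfl⟩ := h1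
    obtain ⟨a', b', ⟨⟨_, h3'⟩, _, h4'⟩, h5⟩ := h2
    obtain ⟨rfl, rfl⟩ := List.cons.inj h5
    exact hpq (Prod.ext (h3.symm.trans h3') (h4.symm.trans h4'))

theorem ncnt_add (P : AT n → Prop) (m : ℕ) :
    ncnt P m + (if m = 0 then 1 else 0) + cnt P m = lcnt P m := by
  rcases Nat.eq_zero_or_pos m with rfl | hm
  · rw [cnt_zero, lcnt_zero]
    have : ncnt P 0 = 0 := by
      unfold ncnt
      rw [Set.ncard_eq_zero (finite_sizeList _ _)]
      ext ts
      have := length_le_sizeList ts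
      simp only [Set.mem_ofPred_eq, Set.mem_empty_iff_false, iff_false]
      rintro ⟨⟨h, _⟩, h2⟩
      omega
    simp [this]
  · have h1 : cnt P m = ((fun t => [t]) '' {t : AT n | P t ∧ size t = m}).ncard := by
      rw [Set.ncard_image_of_injective, cnt]
      intro a b h
      simpa using h
    rw [if_neg (by omega), h1, add_zero, ncnt, lcnt,
      ← Set.ncard_union_eq _ (finite_sizeList _ _) ((finite_size _ _).image _)]
    · congr 1
      ext ts
      match ts with
      | [] => simp [sizeList]; omega
      | [t] => simp [sizeList]
      | t :: t' :: ts => simp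
    · rw [Set.disjoint_left]
      rintro ts ⟨⟨h, _⟩, _⟩ ⟨t, _, rfl⟩
      simp at h

theorem wf_node_iff (c : Bool) (ts : List (AT n)) :
    WF (.node c ts) ↔ 2 ≤ ts.length ∧ ∀ t ∈ ts, (WF t ∧ rootConn t ≠ some c) := by
  constructor
  · intro h
    cases h with
    | node _ _ h1 h2 h3 => exact ⟨h1, fun t ht => ⟨h2 t ht, h3 t ht⟩⟩
  · rintro ⟨h1, h2⟩
    exact WF.node c ts h1 (fun t ht => (h2 t ht).1) (fun t ht => (h2 t ht).2)

/-- Well-formed trees whose root does not carry the connective `c`. -/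
def Pc (c : Bool) (t : AT n) : Prop := WF t ∧ rootConn t ≠ some c

theorem ncard_node (c : Bool) (P : AT n → Prop) (m : ℕ) :
    {t : AT n | ∃ ts, t = .node c ts ∧ (2 ≤ ts.length ∧ ∀ t ∈ ts, P t) ∧ sizeList ts = m}.ncard
      = ncnt P m := by
  have : {t : AT n | ∃ ts, t = .node c ts ∧ (2 ≤ ts.length ∧ ∀ t ∈ ts, P t) ∧ sizeList ts = m}
      = AT.node c '' {ts | (2 ≤ ts.length ∧ ∀ t ∈ ts, P t) ∧ sizeList ts = m} := by
    ext t
    constructor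
    · rintro ⟨ts, rfl, h⟩; exact ⟨ts, h, rfl⟩
    · rintro ⟨ts, h, rfl⟩; exact ⟨ts, rfl, h⟩
  rw [this, Set.ncard_image_of_injective, ncnt]
  intro a b h
  simpa using h

theorem cnt_Pc_one (c : Bool) : cnt (Pc (n := n) c) 1 = 2 * n := by
  have : {t : AT n | Pc c t ∧ size t = 1} =
      (fun p : Fin n × Bool => AT.leaf p.1 p.2) '' Set.univ := by
    ext t
    cases t with
    | leaf i b =>
      simp [Pc, rootConn, size, WF.leaf]
    | node d ts =>
      have := length_le_sizeList ts
      simp only [Pc, wf_node_iff, size, Set.mem_ofPred_eq, Set.mem_image]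
      constructor
      · rintro ⟨⟨⟨h1, _⟩, _⟩, h2⟩; omega
      · rintro ⟨p, _, hp⟩; cases hp
  rw [cnt, this, Set.ncard_image_of_injective, Set.ncard_univ]
  · simp [Nat.card_eq_fintype_card, mul_comm]
  · rintro ⟨a, b⟩ ⟨c, d⟩ h
    simpa using h

theorem cnt_Pc_succ (c : Bool) (m : ℕ) :
    cnt (Pc (n := n) c) (m + 2) = ncnt (Pc (n := n) (!c)) (m + 1) := by
  rw [← ncard_node (!c), cnt]
  congr 1
  ext t
  cases t with
  | leaf i b => simp [size]
  | node d ts =>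
    simp only [Pc, Set.mem_ofPred_eq, wf_node_iff, rootConn, size, AT.node.injEq]
    constructor
    · rintro ⟨⟨h1, h2⟩, h3⟩
      have hd : d = !c := by cases c <;> cases d <;> simp_all
      subst hd
      exact ⟨ts, ⟨rfl, rfl⟩, h1, by omega⟩
    · rintro ⟨ts', ⟨rfl, rfl⟩, h1, h2⟩
      exact ⟨⟨h1, by cases c <;> simp⟩, by omega⟩

theorem sym_aux (m : ℕ) : ∀ k ≤ m, cnt (Pc (n := n) true) k = cnt (Pc (n := n) false) k ∧
    lcnt (Pc (n := n) true) k = lcnt (Pc (n := n) false) k := by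
  induction m with
  | zero =>
    intro k hk
    obtain rfl : k = 0 := by omega
    simp [cnt_zero, lcnt_zero]
  | succ m ih =>
    have h1 : cnt (Pc (n := n) true) (m + 1) = cnt (Pc (n := n) false) (m + 1) := by
      cases m with
      | zero => simp [cnt_Pc_one]
      | succ m =>
        rw [cnt_Pc_succ, cnt_Pc_succ]
        have e1 := ncnt_add (Pc (n := n) true) (m + 1)
        have e2 := ncnt_add (Pc (n := n) false) (m + 1)
        obtain ⟨e3, e4⟩ := ih (m + 1) le_rfl
        simp only [Bool.not_true, Bool.not_false]
        omega
    have h2 : ∀ k ≤ m + 1, cnt (Pc (n := n) true) k = cnt (Pc (n := n) false) k := by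
      intro k hk
      rcases Nat.lt_or_ge k (m + 1) with h | h
      · exact (ih k (by omega)).1
      · obtain rfl : k = m + 1 := by omega
        exact h1
    intro k hk
    refine ⟨h2 k hk, ?_⟩
    rcases Nat.lt_or_ge k (m + 1) with h | h
    · exact (ih k (by omega)).2
    · obtain rfl : k = m + 1 := by omega
      rw [lcnt_succ, lcnt_succ]
      refine Finset.sum_congr rfl ?_
      rintro ⟨i, j⟩ hp
      rw [Finset.HasAntidiagonal.mem_antidiagonal] at hp
      simp only at hp ⊢
      rcases Nat.eq_zero_or_pos i with rfl | hi
      · simp [cnt_zero]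
      · rw [h2 i (by omega), (ih j (by omega)).2]

theorem cnt_sym (c : Bool) (m : ℕ) : cnt (Pc (n := n) c) m = cnt (Pc (n := n) true) m := by
  cases c
  · exact (sym_aux m m le_rfl).1.symm
  · rfl

theorem lcnt_sym (c : Bool) (m : ℕ) : lcnt (Pc (n := n) c) m = lcnt (Pc (n := n) true) m := by
  cases c
  · exact (sym_aux m m le_rfl).2.symm
  · rfl

/-- Well-formed trees whose root does not carry the connective `c` and that are not a leaf
labelled by a literal of `Γ`. -/
def Qc {n₀ : ℕ} (h : n₀ ≤ n) (Γ : Finset (Fin n₀ × Bool)) (c : Bool) (t : AT n) : Prop :=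
  Pc c t ∧ ∀ l ∈ Γ, t ≠ AT.leaf (Fin.castLE h l.1) l.2

theorem cnt_Qc {n₀ : ℕ} (h : n₀ ≤ n) (Γ : Finset (Fin n₀ × Bool)) (c : Bool) (m : ℕ) :
    cnt (Qc h Γ c) m + (if m = 1 then Γ.card else 0) = cnt (Pc (n := n) c) m := by
  split_ifs with hm
  · subst hm
    have h1 : Γ.card = ((fun l : Fin n₀ × Bool => (AT.leaf (Fin.castLE h l.1) l.2 : AT n)) ''
        (Γ : Set (Fin n₀ × Bool))).ncard := by
      rw [Set.ncard_image_of_injective, Set.ncard_coe_finset]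
      rintro ⟨a, b⟩ ⟨c, d⟩ h
      simpa using h
    rw [h1, cnt, cnt, ← Set.ncard_union_eq _ (finite_size _ _)
      ((Finset.finite_toSet _).image _)]
    · congr 1
      ext t
      simp only [Qc, Set.mem_union, Set.mem_ofPred_eq, Set.mem_image, Finset.mem_coe]
      constructor
      · rintro (⟨⟨h1, _⟩, h3⟩ | ⟨l, hl, rfl⟩)
        · exact ⟨h1, h3⟩
        · exact ⟨⟨WF.leaf _ _, by simp [rootConn]⟩, by simp [size]⟩
      · rintro ⟨h1, h2⟩
        by_cases hx : ∃ l ∈ Γ, AT.leaf (Fin.castLE h l.1) l.2 = t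
        · exact Or.inr hx
        · push Not at hx
          exact Or.inl ⟨⟨h1, fun l hl => (hx l hl).symm⟩, h2⟩
    · rw [Set.disjoint_left]
      rintro ts ⟨⟨_, h⟩, _⟩ ⟨l, hl, rfl⟩
      exact h l hl rfl
  · rw [add_zero, cnt, cnt]
    congr 1
    ext t
    simp only [Qc, Set.mem_ofPred_eq]
    constructor
    · rintro ⟨⟨h1, _⟩, h3⟩; exact ⟨h1, h3⟩
    · rintro ⟨h1, h3⟩
      refine ⟨⟨h1, ?_⟩, h3⟩
      rintro l _ rfl
      simp [size] at h3
      omega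

theorem lQ_sym {n₀ : ℕ} (h : n₀ ≤ n) (Γ : Finset (Fin n₀ × Bool)) (c : Bool) (m : ℕ) :
    lcnt (Qc h Γ c) m = lcnt (Qc h Γ true) m := by
  have hc : ∀ k, cnt (Qc h Γ c) k = cnt (Qc h Γ true) k := by
    intro k
    have e1 := cnt_Qc h Γ c k
    have e2 := cnt_Qc h Γ true k
    have e3 := cnt_sym (n := n) c k
    omega
  induction m using Nat.strong_induction_on with
  | _ m ih =>
    cases m with
    | zero => simp [lcnt_zero]
    | succ m =>
      rw [lcnt_succ, lcnt_succ]
      refine Finset.sum_congr rfl ?_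
      rintro ⟨i, j⟩ hp
      rw [Finset.HasAntidiagonal.mem_antidiagonal] at hp
      simp only at hp ⊢
      rcases Nat.eq_zero_or_pos i with rfl | hi
      · simp [cnt_zero]
      · rw [hc, ih j (by omega)]

theorem ncard_nodes (P : Bool → AT n → Prop) (m : ℕ) :
    {t : AT n | (∃ c ts, t = .node c ts ∧ 2 ≤ ts.length ∧ ∀ t ∈ ts, P c t) ∧
      size t = m + 1}.ncard = ncnt (P true) m + ncnt (P false) m := by
  have fin : ∀ c, {t : AT n | ∃ ts, t = .node c ts ∧ (2 ≤ ts.length ∧ ∀ t ∈ ts, P c t) ∧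
      sizeList ts = m}.Finite := by
    intro c
    refine (finite_size (fun _ => True) (m + 1)).subset ?_
    rintro t ⟨ts, rfl, _, h⟩
    simp [size]; omega
  rw [← ncard_node true, ← ncard_node false, ← Set.ncard_union_eq _ (fin true) (fin false)]
  · congr 1
    ext t
    cases t with
    | leaf i b => simp
    | node d ts =>
      have : 1 + sizeList ts = m + 1 ↔ sizeList ts = m := by omega
      cases d <;> simp [size, this, and_assoc]
  · rw [Set.disjoint_left]
    rintro t ⟨ts, rfl, _⟩ ⟨ts', h, _⟩
    simp at h

theorem A_succ (m : ℕ) : A n (m + 2) =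
    ncnt (Pc (n := n) true) (m + 1) + ncnt (Pc (n := n) false) (m + 1) := by
  rw [← ncard_nodes (fun c => Pc c), A, countIn]
  change ({t : AT n | _} : Set (AT n)).ncard = _
  congr 1
  ext t
  cases t with
  | leaf i b => simp [size]
  | node d ts => cases d <;> simp [wf_node_iff, Pc]

theorem famGamma_succ {n₀ : ℕ} (h : n₀ ≤ n) (Γ : Finset (Fin n₀ × Bool)) (m : ℕ) :
    countIn n (famGamma h Γ) (m + 2) + (ncnt (Qc h Γ true) (m + 1) + ncnt (Qc h Γ false) (m + 1))
      = A n (m + 2) := by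
  rw [← ncard_nodes (fun c => Qc h Γ c), A, countIn, countIn]
  change ({t : AT n | _} : Set (AT n)).ncard + _ = ({t : AT n | _} : Set (AT n)).ncard
  rw [← Set.ncard_union_eq _
    ((finite_size (fun _ => True) (m + 2)).subset (fun t ht => ⟨trivial, ht.2.2⟩))
    ((finite_size (fun _ => True) (m + 2)).subset (fun t ht => ⟨trivial, ht.2⟩))]
  · congr 1
    ext t
    cases t with
    | leaf i b => simp [size]
    | node d ts =>
      simp only [Set.mem_union, Set.mem_ofPred_eq, famGamma, rootChildren, wf_node_iff, Qc, Pc,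
        Set.mem_univ, true_and, AT.node.injEq]
      constructor
      · rintro (⟨_, h1, h2⟩ | ⟨⟨c, ts', ⟨rfl, rfl⟩, h1, h2⟩, h3⟩)
        · exact ⟨h1, h2⟩
        · exact ⟨⟨h1, fun t ht => (h2 t ht).1⟩, h3⟩
      · rintro ⟨⟨h1, h2⟩, h3⟩
        by_cases hx : ∃ l ∈ Γ, AT.leaf (Fin.castLE h l.1) l.2 ∈ ts
        · exact Or.inl ⟨hx, ⟨h1, h2⟩, h3⟩
        · push Not at hx
          refine Or.inr ⟨⟨d, ts, ⟨rfl, rfl⟩, h1, fun t ht => ⟨h2 t ht, ?_⟩⟩, h3⟩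
          rintro l hl rfl
          exact hx l hl ht
  · rw [Set.disjoint_left]
    rintro t ⟨⟨l, hl, h1⟩, _⟩ ⟨⟨c, ts, rfl, h2, h3⟩, _⟩
    exact (h3 _ h1).2 l hl rfl

end AT

section Series

open PowerSeries

theorem sqrt_rec (y : ℝ⟦X⟧) (p q : ℝ) (hy : y * y = 1 - C p * X + C q * (X * X)) (m : ℕ) :
    ((m : ℝ) + 4) * coeff (m + 4) y = p * (m + 5 / 2) * coeff (m + 3) y
      - q * (m + 1) * coeff (m + 2) y := by
  have h1 := congrArg (PowerSeries.derivative (R := ℝ)) hy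
  simp only [Derivation.leibniz, map_add, map_sub, derivative_C, derivative_X, smul_eq_mul,
    derivative_one] at h1
  have h2 : 2 * derivative ℝ y - C (2 * p) * (X * derivative ℝ y)
      + C (2 * q) * (X * (X * derivative ℝ y)) = C (2 * q) * (X * y) - C p * y := by
    have e : (C (2 * p) : ℝ⟦X⟧) = 2 * C p := by rw [map_mul]; rfl
    have e' : (C (2 * q) : ℝ⟦X⟧) = 2 * C q := by rw [map_mul]; rfl
    rw [e, e']
    linear_combination (-2 * derivative ℝ y) * hy + y * h1
  have h3 := congrArg (coeff (m + 3)) h2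
  have e2 : (2 : ℝ⟦X⟧) = C 2 := by rfl
  rw [e2] at h3
  simp only [map_add, map_sub, coeff_C_mul, coeff_succ_X_mul, coeff_derivative] at h3
  push_cast at h3
  linear_combination h3 / 2

theorem series_rec (b l w : ℕ → ℝ) (N g : ℝ)
    (hb0 : b 0 = 0) (hb1 : b 1 = 2 * N) (hl0 : l 0 = 1) (hw0 : w 0 = 1)
    (hl : ∀ m, l (m + 1) = ∑ p ∈ Finset.HasAntidiagonal.antidiagonal (m + 1), b p.1 * l p.2)
    (hw : ∀ m, w (m + 1) = ∑ p ∈ Finset.HasAntidiagonal.antidiagonal (m + 1),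
      (b p.1 - if p.1 = 1 then g else 0) * w p.2)
    (hbl : ∀ m, b (m + 2) + b (m + 1) = l (m + 1)) (m : ℕ) :
    (((m : ℝ) + 4) * (b (m + 4) + b (m + 3)) = 4 * N * (m + 5 / 2) * (b (m + 3) + b (m + 2))
      - (4 * N ^ 2 - 8 * N) * (m + 1) * (b (m + 2) + b (m + 1))) ∧
    ((1 + g) * w (m + 3) + g * (2 - 2 * N + g) * w (m + 2) + g ^ 2 * w (m + 1)
      = b (m + 4) + b (m + 3)) := by
  set B : ℝ⟦X⟧ := PowerSeries.mk b with hB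
  set L : ℝ⟦X⟧ := PowerSeries.mk l with hL
  set W : ℝ⟦X⟧ := PowerSeries.mk w with hW
  have e1 : L = 1 + B * L := by
    ext k
    cases k with
    | zero => simp [hB, hL, hb0, hl0]
    | succ k =>
      rw [map_add, coeff_mul, coeff_one]
      simp [hB, hL, hl]
  have e2 : W = 1 + (B - C g * X) * W := by
    ext k
    cases k with
    | zero => simp [hB, hW, hb0, hw0]
    | succ k =>
      rw [map_add, coeff_mul, coeff_one]
      simp [hB, hW, hw, coeff_X]
  have e3 : B = C (2 * N) * X + X * (L - 1 - B) := by
    ext k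
    match k with
    | 0 => simp [hB, hb0]
    | 1 =>
      rw [map_add, coeff_succ_X_mul, coeff_C_mul]
      simp [hB, hL, hb0, hb1, hl0]
    | k + 2 =>
      have := hbl k
      rw [map_add, coeff_succ_X_mul, coeff_C_mul]
      simp [hB, hL, coeff_X, coeff_one]
      linarith
  have e4 : (1 + X) * (B * B) - (1 + C (2 * N) * X) * B + C (2 * N) * X = 0 := by
    linear_combination (B - 1) * e3 - X * e1
  constructor
  · set y : ℝ⟦X⟧ := 1 + C (2 * N) * X - C 2 * (B + X * B) with hy
    have hyy : y * y = 1 - C (4 * N) * X + C (4 * N ^ 2 - 8 * N) * (X * X) := by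
      have c1 : (C 2 : ℝ⟦X⟧) = 2 := rfl
      have c2 : (C 4 : ℝ⟦X⟧) = 4 := rfl
      have c3 : (C 8 : ℝ⟦X⟧) = 8 := rfl
      rw [hy]
      simp only [map_mul, map_sub, map_pow, c1, c2, c3] at e4 ⊢
      linear_combination 4 * (1 + X) * e4
    have hr := sqrt_rec y _ _ hyy m
    have hc : ∀ k, coeff (k + 2) y = -2 * (b (k + 2) + b (k + 1)) := by
      intro k
      rw [hy]
      simp only [map_add, map_sub, coeff_C_mul, coeff_succ_X_mul]
      simp [hB, coeff_X, coeff_one]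
    rw [hc (m + 2), hc (m + 1), hc m] at hr
    linear_combination (-1 / 2) * hr
  · have hN : C (1 + g) * (X * W) + C (g * (2 - 2 * N + g)) * (X * (X * W))
        + C (g ^ 2) * (X * (X * (X * W))) =
        (1 + C g * X) * (1 + X) - (1 + C (2 * N) * X) + (B + X * B) := by
      have c1 : (C 2 : ℝ⟦X⟧) = 2 := rfl
      simp only [map_mul, map_sub, map_pow, map_add, map_one, c1] at e4 ⊢
      linear_combination (W : ℝ⟦X⟧) * e4 + ((1 + C g * X) * (1 + X) - (1 + 2 * C N * X) + (B + X * B)) * e2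
    have h3 := congrArg (coeff (m + 4)) hN
    have e5 : ((1 + C g * X) * (1 + X) - (1 + C (2 * N) * X) + (B + X * B) : ℝ⟦X⟧)
      = 1 + X * (C g + 1) + X * (X * C g) - 1 - X * C (2 * N) + (B + X * B) := by ring
    rw [e5] at h3
    rw [map_add, map_add, coeff_C_mul, coeff_C_mul, coeff_C_mul] at h3
    simp only [map_add, map_sub, coeff_succ_X_mul] at h3
    simp [hW, hB, coeff_one] at h3
    linarith

end Series

section Analysis

open Filter Topology

theorem contract1 (e ε : ℕ → ℝ) (θ : ℝ) (he : ∀ m, 0 ≤ e m) (hθ0 : 0 ≤ θ) (hθ : θ < 1)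
    (hε : Tendsto ε atTop (𝓝 0)) (h : ∀ᶠ m in atTop, e (m + 1) ≤ θ * e m + ε m) :
    Tendsto e atTop (𝓝 0) := by
  rw [Metric.tendsto_atTop]
  intro δ hδ
  have hη : 0 < (1 - θ) * (δ / 2) := mul_pos (by linarith) (by linarith)
  obtain ⟨M, hM⟩ := eventually_atTop.mp (h.and (hε.eventually (gt_mem_nhds hη)))
  have key : ∀ k, e (M + k) ≤ δ / 2 + θ ^ k * e M := by
    intro k
    induction k with
    | zero => simp; linarith
    | succ k ih =>
      obtain ⟨h1, h2⟩ := hM (M + k) (by omega)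
      have : θ * e (M + k) ≤ θ * (δ / 2 + θ ^ k * e M) := mul_le_mul_of_nonneg_left ih hθ0
      rw [pow_succ, ← add_assoc]
      nlinarith
  have hpow : Tendsto (fun k => θ ^ k * e M) atTop (𝓝 (0 * e M)) :=
    (tendsto_pow_atTop_nhds_zero_of_lt_one hθ0 hθ).mul_const _
  rw [zero_mul] at hpow
  obtain ⟨K, hK⟩ := eventually_atTop.mp (hpow.eventually (gt_mem_nhds (half_pos hδ)))
  refine ⟨M + K, fun m hm => ?_⟩
  obtain ⟨k, rfl⟩ : ∃ k, m = M + k := ⟨m - M, by omega⟩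
  have := key k
  have := hK k (by omega)
  rw [Real.dist_eq, sub_zero, abs_of_nonneg (he _)]
  linarith

theorem contract2 (e ε : ℕ → ℝ) (a b : ℝ) (he : ∀ m, 0 ≤ e m) (hb : 0 ≤ b)
    (hab : a + b < 1)
    (hε : Tendsto ε atTop (𝓝 0))
    (h : ∀ᶠ m in atTop, e (m + 2) ≤ a * e (m + 1) + b * e m + ε m) :
    Tendsto e atTop (𝓝 0) := by
  set κ := b + (1 - a - b) / 2 with hκ
  have hκ0 : 0 < κ := by linarith
  have hbκ : b < κ := by linarith
  have hb1 : b / κ < 1 := (div_lt_one hκ0).mpr hbκ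
  set θ := max (a + κ) (b / κ) with hθ
  have hθ1 : θ < 1 := max_lt (by linarith) hb1
  have hθ0 : 0 ≤ θ := le_trans (by positivity) (le_max_right _ _)
  have hE : Tendsto (fun m => e (m + 1) + κ * e m) atTop (𝓝 0) := by
    refine contract1 _ ε θ (fun m => add_nonneg (he _) (mul_nonneg hκ0.le (he _))) hθ0 hθ1 hε ?_
    filter_upwards [h] with m hm
    have h1 : (a + κ) * e (m + 1) ≤ θ * e (m + 1) :=
      mul_le_mul_of_nonneg_right (le_max_left _ _) (he _)
    have h2 : b * e m ≤ θ * (κ * e m) := by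
      rw [← mul_assoc]
      refine mul_le_mul_of_nonneg_right ?_ (he _)
      exact (div_le_iff₀ hκ0).mp (le_max_right _ _)
    show e (m + 2) + κ * e (m + 1) ≤ _
    nlinarith
  have hs : Tendsto (fun m => e (m + 1)) atTop (𝓝 0) :=
    squeeze_zero (fun m => he _) (fun m => by have := mul_nonneg hκ0.le (he m); linarith) hE
  exact (tendsto_add_atTop_iff_nat 1).mp hs

theorem contract_lim (r f g h : ℕ → ℝ) (F G H R : ℝ) (hf : Tendsto f atTop (𝓝 F))
    (hg : Tendsto g atTop (𝓝 G)) (hh : Tendsto h atTop (𝓝 H)) (hGH : |G| + |H| < 1)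
    (hR : R = F + G * R + H * R)
    (hr : ∀ᶠ m in atTop, r (m + 2) = f m + g m * r (m + 1) + h m * r m) :
    Tendsto r atTop (𝓝 R) := by
  set d := (1 - |G| - |H|) / 4 with hd
  have hd0 : 0 < d := by linarith
  have ha := hg.abs.eventually (gt_mem_nhds (show |G| < |G| + d by linarith))
  have hb := hh.abs.eventually (gt_mem_nhds (show |H| < |H| + d by linarith))
  have hε : Tendsto (fun m => |f m - F + (g m - G) * R + (h m - H) * R|) atTop (𝓝 0) := by
    have := (((hf.sub_const F).add ((hg.sub_const G).mul_const R)).add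
      ((hh.sub_const H).mul_const R)).abs
    simpa using this
  have hA := abs_nonneg G
  have hB := abs_nonneg H
  have := contract2 (fun m => |r m - R|) _ (|G| + d) (|H| + d) (fun m => abs_nonneg _)
    (by linarith) (by linarith) hε (by
      filter_upwards [ha, hb, hr] with m h1 h2 h3
      have e : r (m + 2) - R = g m * (r (m + 1) - R) + h m * (r m - R) +
          (f m - F + (g m - G) * R + (h m - H) * R) := by
        rw [h3]; linear_combination -hR
      calc |r (m + 2) - R| ≤ |g m * (r (m + 1) - R)| + |h m * (r m - R)| +
          |f m - F + (g m - G) * R + (h m - H) * R| := by rw [e]; exact abs_add_three _ _ _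
        _ ≤ _ := by
          rw [abs_mul, abs_mul]
          gcongr)
  exact tendsto_sub_nhds_zero_iff.mp ((tendsto_zero_iff_abs_tendsto_zero _).mpr this)

theorem lim_affine (a : ℝ) (k : ℝ) : Tendsto (fun m : ℕ => ((m : ℝ) + a) / (m + k)) atTop (𝓝 1) := by
  have h0 : Tendsto (fun m : ℕ => (m : ℝ) + k) atTop atTop :=
    tendsto_atTop_add_const_right _ _ tendsto_natCast_atTop_atTop
  have h : Tendsto (fun m : ℕ => 1 + (a - k) / ((m : ℝ) + k)) atTop (𝓝 (1 + 0)) :=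
    (h0.const_div_atTop _).const_add 1
  rw [add_zero] at h
  refine h.congr' ?_
  filter_upwards [h0.eventually_gt_atTop 0] with m hm
  field_simp
  ring

/-- The main analytic statement. -/
theorem main_lim (b l w : ℕ → ℝ) (N g s : ℝ) (hN : 1 ≤ N) (hg0 : 1 ≤ g) (hgN : g ≤ 2 * N)
    (hs0 : 0 < s) (hs : s ^ 2 = 2 * N)
    (hbn : ∀ m, 0 ≤ b m) (hln : ∀ m, 0 ≤ l m)
    (hb0 : b 0 = 0) (hb1 : b 1 = 2 * N) (hl0 : l 0 = 1) (hw0 : w 0 = 1)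
    (hl : ∀ m, l (m + 1) = ∑ p ∈ Finset.HasAntidiagonal.antidiagonal (m + 1), b p.1 * l p.2)
    (hw : ∀ m, w (m + 1) = ∑ p ∈ Finset.HasAntidiagonal.antidiagonal (m + 1),
      (b p.1 - if p.1 = 1 then g else 0) * w p.2)
    (hbl : ∀ m, b (m + 2) + b (m + 1) = l (m + 1)) (ρ : ℝ) (hρ : ρ = 1 / (2 * (N + s))) :
    (∀ m, 0 < b (m + 3)) ∧
    Tendsto (fun m => 1 + b (m + 1) / b (m + 2) - w (m + 1) / b (m + 2)) atTop
      (𝓝 ((1 + ρ) * (1 - 1 / (1 + g + g * (2 - 2 * N + g) * ρ + g ^ 2 * ρ ^ 2)))) := by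
  have hrec := series_rec b l w N g hb0 hb1 hl0 hw0 hl hw hbl
  have hgrow : ∀ m, 2 * N * (b (m + 2) + b (m + 1)) ≤ b (m + 3) := by
    intro m
    have h1 : b 1 * l (m + 1) + b (m + 2) * l 0 ≤ l (m + 2) := by
      rw [hl (m + 1)]
      have hsub : ({(1, m + 1), (m + 2, 0)} : Finset (ℕ × ℕ)) ⊆
          Finset.HasAntidiagonal.antidiagonal (m + 1 + 1) := by
        intro p hp
        simp only [Finset.mem_insert, Finset.mem_singleton] at hp
        rw [Finset.HasAntidiagonal.mem_antidiagonal]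
        rcases hp with rfl | rfl
        · show 1 + (m + 1) = m + 1 + 1
          omega
        · show m + 2 + 0 = m + 1 + 1
          omega
      refine le_trans (le_of_eq ?_) (Finset.sum_le_sum_of_subset_of_nonneg hsub
        (fun p _ _ => mul_nonneg (hbn _) (hln _)))
      rw [Finset.sum_pair]
      simp
    have h2 := hbl m
    have h3 := hbl (m + 1)
    rw [hb1, hl0, ← h2, ← h3] at h1
    linarith
  obtain ⟨c, hc⟩ : ∃ c : ℕ → ℝ, ∀ m, c m = b (m + 2) + b (m + 1) := ⟨_, fun _ => rfl⟩
  have hcg : ∀ m, 2 * N * c m ≤ c (m + 1) := by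
    intro m
    rw [hc, hc]
    have := hgrow m
    have := hbn (m + 2)
    show _ ≤ b (m + 3) + b (m + 2)
    linarith
  have hcpos : ∀ m, 0 < c m := by
    intro m
    induction m with
    | zero =>
      rw [hc]
      have h1 : b (0 + 1) = 2 * N := hb1
      have := hbn (0 + 2)
      linarith
    | succ m ih => exact lt_of_lt_of_le (by positivity) (hcg m)
  have hbpos : ∀ m, 0 < b (m + 3) := by
    intro m
    refine lt_of_lt_of_le ?_ (hgrow m)
    rw [← hc]
    have := hcpos m
    positivity
  refine ⟨hbpos, ?_⟩
  have hρ0 : 0 < ρ := by rw [hρ]; positivity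
  have hρN : 2 * ρ * N < 1 := by
    rw [hρ]
    have : 0 < N + s := by linarith
    rw [show 2 * (1 / (2 * (N + s))) * N = N / (N + s) by field_simp]
    rw [div_lt_one this]; linarith
  have hρα : ρ * (2 * (N + s)) = 1 := by
    rw [hρ]
    have : 0 < N + s := by linarith
    field_simp
  have hs2 : s < 2 * N := by nlinarith
  -- ratio of c
  have ht : Tendsto (fun m => c (m + 1) / c m) atTop (𝓝 (2 * (N + s))) := by
    have hA : Tendsto (fun m : ℕ => 4 * N * |((m : ℝ) + 5 / 2) / (m + 4) - 1|
        + |4 * N ^ 2 - 8 * N| / (2 * N) * |((m : ℝ) + 1) / (m + 4) - 1|) atTop (𝓝 0) := by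
      have := (((lim_affine (5 / 2) 4).sub_const 1).abs.const_mul (4 * N)).add
        (((lim_affine 1 4).sub_const 1).abs.const_mul (|4 * N ^ 2 - 8 * N| / (2 * N)))
      simpa using this
    have hθ : |2 * (N - s)| / (2 * N) < 1 := by
      rw [div_lt_one (by linarith), abs_lt]
      constructor <;> linarith
    have h0 := contract1 (fun m => |c (m + 1) / c m - 2 * (N + s)|) _ (|2 * (N - s)| / (2 * N))
      (fun m => abs_nonneg _) (by positivity) hθ hA (by
        refine Eventually.of_forall fun m => ?_
        have h1 := (hrec m).1
        have e0 : b (m + 4) + b (m + 3) = c (m + 2) := (hc _).symm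
        have e1 : b (m + 3) + b (m + 2) = c (m + 1) := (hc _).symm
        rw [e0, e1, ← hc] at h1
        have p0 := hcpos m
        have p1 := hcpos (m + 1)
        have hm : (0 : ℝ) < m + 4 := by positivity
        obtain ⟨t, htd⟩ : ∃ t, t = c (m + 1) / c m := ⟨_, rfl⟩
        have ht2 : 2 * N ≤ t := by rw [htd, le_div_iff₀ p0]; exact hcg m
        have htp : 0 < t := by linarith
        have e2 : c (m + 1) = t * c m := by rw [htd]; field_simp
        have e3 : c (m + 1 + 1) / c (m + 1) - 2 * (N + s) =
            4 * N * (((m : ℝ) + 5 / 2) / (m + 4) - 1)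
            - (4 * N ^ 2 - 8 * N) / t * (((m : ℝ) + 1) / (m + 4) - 1)
            + 2 * (N - s) / t * (t - 2 * (N + s)) := by
          have e4 : c (m + 2) = (4 * N * (m + 5 / 2) * c (m + 1)
            - (4 * N ^ 2 - 8 * N) * (m + 1) * c m) / (m + 4) := by
            rw [eq_div_iff hm.ne']; linarith
          show c (m + 2) / c (m + 1) - _ = _
          rw [e4, e2]
          field_simp
          linear_combination (-8 * ((m : ℝ) + 4)) * hs
        show |c (m + 1 + 1) / c (m + 1) - 2 * (N + s)| ≤ _
        rw [e3]
        refine (abs_add_le _ _).trans ?_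
        rw [← htd, add_comm]
        refine add_le_add ?_ ?_
        · rw [abs_mul, abs_div, abs_of_pos htp]
          gcongr
        · refine (abs_sub _ _).trans ?_
          rw [abs_mul (4 * N), abs_mul (_ / t), abs_div, abs_of_pos htp,
            abs_of_pos (by linarith : 0 < 4 * N)]
          gcongr)
    exact tendsto_sub_nhds_zero_iff.mp ((tendsto_zero_iff_abs_tendsto_zero _).mpr h0)
  have hti : Tendsto (fun m => c m / c (m + 1)) atTop (𝓝 ρ) := by
    have := ht.inv₀ (by linarith)
    simp only [inv_div] at this
    rwa [show ρ = (2 * (N + s))⁻¹ by rw [hρ, one_div]]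
  have hx : Tendsto (fun m => b (m + 2) / c m) atTop (𝓝 (1 / (1 + ρ))) := by
    refine contract_lim _ (fun _ => 1) (fun m => -(c (m + 1) / c (m + 2))) (fun _ => 0) 1 (-ρ) 0 _
      tendsto_const_nhds ?_ tendsto_const_nhds ?_ ?_ ?_
    · exact ((tendsto_add_atTop_iff_nat 1).mpr hti).neg
    · rw [abs_neg, abs_of_pos hρ0, abs_zero]
      nlinarith
    · field_simp; ring
    · refine Eventually.of_forall fun m => ?_
      have p1 := hcpos (m + 1)
      have p2 := hcpos (m + 2)
      have e : b (m + 4) = c (m + 2) - b (m + 3) := by rw [hc]; ring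
      show b (m + 4) / c (m + 2) = 1 + -(c (m + 1) / c (m + 2)) * (b (m + 3) / c (m + 1)) + 0 * _
      rw [e]
      field_simp
      ring
  have hv : Tendsto (fun m => b (m + 1) / b (m + 2)) atTop (𝓝 ρ) := by
    rw [← tendsto_add_atTop_iff_nat 1]
    have h1 := (hx.div ((tendsto_add_atTop_iff_nat 1).mpr hx) (by positivity)).mul hti
    rw [div_self (by positivity), one_mul] at h1
    refine h1.congr fun m => ?_
    have p1 := hcpos m
    have p2 := hcpos (m + 1)
    have p3 := hbpos m
    show b (m + 2) / c m / (b (m + 3) / c (m + 1)) * _ = b (m + 2) / b (m + 3)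
    field_simp
  have hρ1 : ρ < 1 := by nlinarith
  -- the perturbed sequence
  obtain ⟨K, hK⟩ : ∃ K, K = g * (2 - 2 * N + g) := ⟨_, rfl⟩
  have hK1 : |K| * ρ < g := by
    rw [hK, abs_mul, abs_of_pos (by linarith : 0 < g), mul_assoc]
    have : |2 - 2 * N + g| * ρ < 1 := by
      rcases abs_cases (2 - 2 * N + g) with ⟨h, _⟩ | ⟨h, _⟩ <;> rw [h] <;> nlinarith
    nlinarith
  have hgρ : g ^ 2 * ρ ^ 2 < 1 := by
    have : g * ρ < 1 := by nlinarith
    have h0 : 0 < g * ρ := by positivity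
    nlinarith
  have hKρ : -(|K| * ρ) ≤ K * ρ := by
    have := neg_abs_le K
    nlinarith
  have hD : 0 < 1 + g + K * ρ + g ^ 2 * ρ ^ 2 := by
    have : 0 < g ^ 2 * ρ ^ 2 := by positivity
    linarith
  have hr : Tendsto (fun m => w (m + 1) / b (m + 1)) atTop
      (𝓝 ((2 * (N + s) + 1) / (1 + g + K * ρ + g ^ 2 * ρ ^ 2))) := by
    have hv1 := (tendsto_add_atTop_iff_nat 1).mpr hv
    have hv2 := ((tendsto_add_atTop_iff_nat 2).mpr hv).inv₀ hρ0.ne'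
    refine contract_lim _ (fun m => ((b (m + 2 + 1) / b (m + 2 + 2))⁻¹ + 1) / (1 + g))
      (fun m => -K / (1 + g) * (b (m + 1 + 1) / b (m + 1 + 2)))
      (fun m => -g ^ 2 / (1 + g) * (b (m + 1) / b (m + 2) * (b (m + 1 + 1) / b (m + 1 + 2))))
      ((ρ⁻¹ + 1) / (1 + g)) (-K / (1 + g) * ρ) (-g ^ 2 / (1 + g) * (ρ * ρ)) _
      ((hv2.add_const 1).div_const _) (hv1.const_mul _) ((hv.mul hv1).const_mul _) ?_ ?_ ?_
    · rw [abs_mul, abs_mul, abs_div, abs_div, abs_neg, abs_neg, abs_of_pos hρ0,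
        abs_of_pos (by linarith : 0 < 1 + g), abs_of_pos (by positivity : 0 < g ^ 2),
        abs_of_pos (by positivity : 0 < ρ * ρ)]
      rw [div_mul_eq_mul_div, div_mul_eq_mul_div, ← add_div, div_lt_one (by linarith)]
      nlinarith
    · have e : ρ⁻¹ = 2 * (N + s) := by rw [hρ, one_div, inv_inv]
      rw [e]
      have : 0 < 1 + g := by linarith
      field_simp
      ring
    · filter_upwards [eventually_ge_atTop 2] with m hm
      have h2 := (hrec m).2
      rw [← hK] at h2
      obtain ⟨k, rfl⟩ : ∃ k, m = k + 2 := ⟨m - 2, by omega⟩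
      have p1 : 0 < b (k + 2 + 1) := hbpos _
      have p2 : 0 < b (k + 2 + 2) := hbpos (k + 1)
      have p3 : 0 < b (k + 2 + 3) := hbpos (k + 2)
      have p4 : 0 < b (k + 2 + 4) := hbpos (k + 3)
      have hg1 : 0 < 1 + g := by linarith
      show w (k + 2 + 3) / b (k + 2 + 3) = ((b (k + 2 + 3) / b (k + 2 + 4))⁻¹ + 1) / (1 + g) +
        -K / (1 + g) * (b (k + 2 + 2) / b (k + 2 + 3)) * (w (k + 2 + 2) / b (k + 2 + 2)) +
        -g ^ 2 / (1 + g) * (b (k + 2 + 1) / b (k + 2 + 2) * (b (k + 2 + 2) / b (k + 2 + 3))) *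
          (w (k + 2 + 1) / b (k + 2 + 1))
      rw [inv_div]
      field_simp
      linear_combination h2
  have hfin := (hv.const_add 1).sub (hr.mul hv)
  rw [← hK]
  have elim : 1 + ρ - (2 * (N + s) + 1) / (1 + g + K * ρ + g ^ 2 * ρ ^ 2) * ρ =
      (1 + ρ) * (1 - 1 / (1 + g + K * ρ + g ^ 2 * ρ ^ 2)) := by
    have e : (2 * (N + s) + 1) * ρ = 1 + ρ := by linear_combination hρα
    rw [div_mul_eq_mul_div, e]
    ring
  rw [elim] at hfin
  refine hfin.congr' ?_
  filter_upwards [eventually_ge_atTop 2] with m hm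
  obtain ⟨k, rfl⟩ : ∃ k, m = k + 2 := ⟨m - 2, by omega⟩
  have p1 : 0 < b (k + 2 + 1) := hbpos _
  have p2 : 0 < b (k + 2 + 2) := hbpos (k + 1)
  field_simp

end Analysis

/-- The limiting ratio as an explicit function of `n` and `g`. -/
noncomputable def muFun (g : ℝ) (n : ℕ) : ℝ :=
  (1 + 1 / (2 * ((n : ℝ) + √(2 * n)))) * (1 - 1 / (1 + g
    + g * (2 - 2 * n + g) * (1 / (2 * ((n : ℝ) + √(2 * n))))
    + g ^ 2 * (1 / (2 * ((n : ℝ) + √(2 * n)))) ^ 2))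

set_option maxHeartbeats 1000000 in
theorem muFun_bound (g : ℝ) (hg : 1 ≤ g) (n : ℕ) (hn : 1 ≤ n) :
    |muFun g n - g * √(2 / n)| ≤ (1 + (2 * g + 2 * g ^ 2) ^ 2 + 2 * g + 2 * g ^ 2) * (1 / (n : ℝ)) := by
  have hn' : (1 : ℝ) ≤ n := by exact_mod_cast hn
  obtain ⟨t, ht⟩ : ∃ t, t = √(2 * (n : ℝ)) := ⟨_, rfl⟩
  have ht2 : t ^ 2 = 2 * n := by rw [ht]; exact Real.sq_sqrt (by linarith)
  have ht1 : 1 ≤ t := by rw [ht]; exact Real.one_le_sqrt.mpr (by linarith)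
  have hN : (n : ℝ) = t ^ 2 / 2 := by linarith
  have hs : √(2 / (n : ℝ)) = 2 * (1 / t) := by
    rw [Real.sqrt_eq_iff_mul_self_eq (by positivity) (by positivity), hN]
    field_simp
  unfold muFun
  rw [hs, ← ht, hN]
  obtain ⟨r, hr⟩ : ∃ r, r = 1 / t := ⟨_, rfl⟩
  obtain ⟨ρ, hρ⟩ : ∃ ρ, ρ = 1 / (2 * (t ^ 2 / 2 + t)) := ⟨_, rfl⟩
  rw [← hr, ← hρ]
  have hr0 : 0 < r := by rw [hr]; positivity
  have hr1 : r ≤ 1 := by rw [hr, div_le_one (by linarith)]; exact ht1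
  have hρ0 : 0 < ρ := by rw [hρ]; positivity
  have hrρ : r = (t + 2) * ρ := by rw [hr, hρ]; field_simp
  have hrt : r * t = 1 := by rw [hr]; field_simp
  have hρr : ρ ≤ r ^ 2 := by
    have e : ρ * (1 + 2 * r) = r ^ 2 := by
      have : r ^ 2 = r * ((t + 2) * ρ) := by rw [← hrρ]; ring
      rw [this]; linear_combination (-ρ) * hrt
    nlinarith
  have hρ1 : ρ ≤ 1 := by nlinarith
  have hδe : 1 + g + g * (2 - 2 * (t ^ 2 / 2) + g) * ρ + g ^ 2 * ρ ^ 2 =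
      1 + (2 * g * r - 2 * g * ρ + g ^ 2 * (ρ + ρ ^ 2)) := by
    have e : ρ * (t ^ 2 + 2 * t) = 1 := by rw [hρ]; field_simp
    rw [hrρ]; linear_combination (-g) * e
  obtain ⟨δ, hδ⟩ : ∃ δ, δ = 2 * g * r - 2 * g * ρ + g ^ 2 * (ρ + ρ ^ 2) := ⟨_, rfl⟩
  rw [hδe, ← hδ]
  have hδ0 : 0 ≤ δ := by
    have : ρ ≤ r := by nlinarith
    have h1 : 0 ≤ 2 * g * (r - ρ) := mul_nonneg (by linarith) (by linarith)
    have h2 : 0 ≤ g ^ 2 * (ρ + ρ ^ 2) := by positivity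
    rw [hδ]; linarith
  have hρρ : ρ + ρ ^ 2 ≤ 2 * r ^ 2 := by nlinarith
  have hgg : g ^ 2 * (ρ + ρ ^ 2) ≤ g ^ 2 * (2 * r ^ 2) :=
    mul_le_mul_of_nonneg_left hρρ (by positivity)
  have hgg0 : 0 ≤ g ^ 2 * (ρ + ρ ^ 2) := by positivity
  have hgρ : g * ρ ≤ g * r ^ 2 := mul_le_mul_of_nonneg_left hρr (by linarith)
  have hgρ0 : 0 ≤ g * ρ := by positivity
  have hδr : δ ≤ (2 * g + 2 * g ^ 2) * r := by
    have : r ^ 2 ≤ r := by nlinarith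
    have : g ^ 2 * (2 * r ^ 2) ≤ g ^ 2 * (2 * r) :=
      mul_le_mul_of_nonneg_left (by linarith) (by positivity)
    rw [hδ]; linarith
  have hδ2 : δ ^ 2 ≤ (2 * g + 2 * g ^ 2) ^ 2 * r ^ 2 := by
    rw [← mul_pow]
    exact pow_le_pow_left₀ hδ0 hδr 2
  have hq : 1 - 1 / (1 + δ) = δ / (1 + δ) := by field_simp; ring
  rw [hq]
  have hq1 : δ / (1 + δ) ≤ 1 := by rw [div_le_one (by linarith)]; linarith
  have hq2 : δ / (1 + δ) ≤ δ := div_le_self hδ0 (by linarith)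
  have hq3 : δ - δ ^ 2 ≤ δ / (1 + δ) := by
    rw [le_div_iff₀ (by linarith)]
    nlinarith [pow_nonneg hδ0 3]
  have hq0 : 0 ≤ δ / (1 + δ) := by positivity
  have hrn : r ^ 2 ≤ 1 / (t ^ 2 / 2) := by
    have : 1 / (t ^ 2 / 2) = 2 * r ^ 2 := by rw [hr]; field_simp
    rw [this]; linarith [sq_nonneg r]
  have hmul : ρ * (δ / (1 + δ)) ≤ ρ := mul_le_of_le_one_right hρ0.le hq1
  have hmul0 : 0 ≤ ρ * (δ / (1 + δ)) := by positivity
  have hfin : |(1 + ρ) * (δ / (1 + δ)) - g * (2 * r)| ≤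
      (1 + (2 * g + 2 * g ^ 2) ^ 2 + 2 * g + 2 * g ^ 2) * r ^ 2 := by
    rw [abs_le]
    have hx : 0 ≤ g * r ^ 2 := by positivity
    have hx2 : 0 ≤ g ^ 2 * r ^ 2 := by positivity
    have hx3 : 0 ≤ (2 * g + 2 * g ^ 2) ^ 2 * r ^ 2 := by positivity
    have hx4 : 0 ≤ r ^ 2 := by positivity
    constructor <;> linarith
  exact hfin.trans (mul_le_mul_of_nonneg_left hrn (by positivity))

theorem ratio_lim {n₀ n : ℕ} (h : n₀ ≤ n) (Γ : Finset (Fin n₀ × Bool)) (hΓ : 1 ≤ Γ.card) :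
    HasLimRatio n (famGamma h Γ) (muFun Γ.card n) := by
  have hn : 1 ≤ n := by
    obtain ⟨l, _⟩ := Finset.card_pos.mp hΓ
    have := l.1.2
    omega
  have hn' : (1 : ℝ) ≤ n := by exact_mod_cast hn
  have hQ := fun m => cnt_Qc (n := n) h Γ true m
  have hQr : ∀ m, (cnt (Qc h Γ true) m : ℝ) =
      (cnt (Pc (n := n) true) m : ℝ) - if m = 1 then (Γ.card : ℝ) else 0 := by
    intro m
    rw [← hQ m]
    push_cast
    split_ifs <;> ring
  have hgN : Γ.card ≤ 2 * n := by
    have := hQ 1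
    rw [cnt_Pc_one, if_pos rfl] at this
    omega
  have hsucc : ∀ m, cnt (Pc (n := n) true) (m + 2) + cnt (Pc (n := n) true) (m + 1)
      = lcnt (Pc (n := n) true) (m + 1) := by
    intro m
    have e1 := cnt_Pc_succ (n := n) false m
    have e2 := ncnt_add (Pc (n := n) true) (m + 1)
    rw [cnt_sym, Bool.not_false] at e1
    rw [if_neg (by omega)] at e2
    omega
  obtain ⟨hpos, hlim⟩ := main_lim (fun m => (cnt (Pc (n := n) true) m : ℝ))
    (fun m => (lcnt (Pc (n := n) true) m : ℝ)) (fun m => (lcnt (Qc h Γ true) m : ℝ))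
    n Γ.card (√(2 * n)) hn' (by exact_mod_cast hΓ) (by exact_mod_cast hgN)
    (Real.sqrt_pos.mpr (by linarith)) (Real.sq_sqrt (by linarith))
    (fun m => Nat.cast_nonneg _) (fun m => Nat.cast_nonneg _)
    (by simp [cnt_zero]) (by simp [cnt_Pc_one]) (by simp [lcnt_zero]) (by simp [lcnt_zero])
    (fun m => by rw [lcnt_succ]; push_cast; rfl)
    (fun m => by rw [lcnt_succ]; push_cast; simp only [hQr])
    (fun m => by exact_mod_cast hsucc m) _ rfl
  unfold HasLimRatio
  rw [← Filter.tendsto_add_atTop_iff_nat 2]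
  refine hlim.congr' ?_
  filter_upwards [Filter.eventually_ge_atTop 1] with m hm
  have hp : (cnt (Pc (n := n) true) (m + 2) : ℝ) ≠ 0 := by
    obtain ⟨k, rfl⟩ : ∃ k, m = k + 1 := ⟨m - 1, by omega⟩
    exact (hpos k).ne'
  have a1 := A_succ (n := n) m
  have a2 := famGamma_succ h Γ m
  have b1 := cnt_Pc_succ (n := n) true m
  have b2 := cnt_Pc_succ (n := n) false m
  rw [cnt_sym] at b2
  simp only [Bool.not_true, Bool.not_false] at b1 b2
  have c1 := ncnt_add (Qc h Γ true) (m + 1)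
  have c2 := ncnt_add (Qc h Γ false) (m + 1)
  rw [lQ_sym] at c2
  have d1 := cnt_Qc (n := n) h Γ true (m + 1)
  have d2 := cnt_Qc (n := n) h Γ false (m + 1)
  rw [cnt_sym] at d2
  rw [if_neg (by omega)] at c1 c2 d1 d2
  have hA : A n (m + 2) = 2 * cnt (Pc (n := n) true) (m + 2) := by omega
  have hF : countIn n (famGamma h Γ) (m + 2) + 2 * lcnt (Qc h Γ true) (m + 1) =
      2 * cnt (Pc (n := n) true) (m + 2) + 2 * cnt (Pc (n := n) true) (m + 1) := by omega
  have hF' : (countIn n (famGamma h Γ) (m + 2) : ℝ) =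
      2 * cnt (Pc (n := n) true) (m + 2) + 2 * cnt (Pc (n := n) true) (m + 1)
      - 2 * lcnt (Qc h Γ true) (m + 1) := by
    rw [eq_sub_iff_add_eq]
    exact_mod_cast hF
  unfold ratio
  rw [hA, hF']
  push_cast
  field_simp

open Filter in
/-- For a fixed set `Γ` of `γ ≥ 1` distinct literals, the limiting ratio of `𝒜_Γ`
exists for every `n ≥ n₀` and equals `γ·√(2/n) + O(1/n)` as `n → ∞`. -/
theorem statement7 (n₀ : ℕ) (Γ : Finset (Fin n₀ × Bool)) (hΓ : 1 ≤ Γ.card) :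
    ∃ μ : ℕ → ℝ,
      (∀ n : ℕ, ∀ h : n₀ ≤ n, HasLimRatio n (famGamma h Γ) (μ n)) ∧
      (fun n : ℕ => μ n - (Γ.card : ℝ) * Real.sqrt (2 / (n : ℝ)))
        =O[atTop] (fun n : ℕ => 1 / (n : ℝ)) := by
  refine ⟨muFun Γ.card, fun n h => ratio_lim h Γ hΓ, ?_⟩
  refine Asymptotics.IsBigO.of_bound (1 + (2 * (Γ.card : ℝ) + 2 * (Γ.card : ℝ) ^ 2) ^ 2
    + 2 * (Γ.card : ℝ) + 2 * (Γ.card : ℝ) ^ 2) ?_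
  filter_upwards [eventually_ge_atTop 1] with n hn
  have := muFun_bound Γ.card (by exact_mod_cast hΓ) n hn
  rw [Real.norm_eq_abs, Real.norm_eq_abs, abs_of_nonneg (by positivity : (0 : ℝ) ≤ 1 / n)]
  exact this
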